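/- Let 𝒟 = {X ∈ sp(2n,ℝ) : the centralizer {S ∈ Sp(2n,ℝ) : SX = XS} is compact} be the set of strongly stable elements. Then the conjugation action of Sp(2n,ℝ) on 𝒟 is proper; that is, the map Sp(2n,ℝ) × 𝒟 → 𝒟 × 𝒟, (S, X) ↦ (SXS⁻¹, X), is a proper map. -/

import Mathlib

open Matrix

/-- The standard symplectic form matrix `Ω = [[0, Iₙ], [-Iₙ, 0]]` on `ℝ²ⁿ`
(coordinates indexed by `Fin n ⊕ Fin n`). -/
noncomputable def Omega (n : ℕ) : Matrix (Fin n ⊕ Fin n) (Fin n ⊕ Fin n) ℝ :=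
  Matrix.fromBlocks 0 1 (-1) 0

/-- The real symplectic group `Sp(2n, ℝ) = {S : Sᵀ Ω S = Ω}`. -/
noncomputable def Sp (n : ℕ) : Set (Matrix (Fin n ⊕ Fin n) (Fin n ⊕ Fin n) ℝ) :=
  {S | Sᵀ * Omega n * S = Omega n}

/-- The symplectic Lie algebra `sp(2n, ℝ) = {X : Xᵀ Ω + Ω X = 0}`. -/
noncomputable def sp (n : ℕ) : Set (Matrix (Fin n ⊕ Fin n) (Fin n ⊕ Fin n) ℝ) :=
  {X | Xᵀ * Omega n + Omega n * X = 0}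

/-- The set `𝒟 ⊆ sp(2n,ℝ)` of strongly stable elements: those with compact
centralizer in `Sp(2n,ℝ)`. -/
noncomputable def strongStable (n : ℕ) : Set (Matrix (Fin n ⊕ Fin n) (Fin n ⊕ Fin n) ℝ) :=
  {X ∈ sp n | IsCompact {S ∈ Sp n | S * X = X * S}}


theorem transpose_Omega (n : ℕ) : (Omega n)ᵀ = -Omega n := by
  simp [Omega, fromBlocks_transpose, fromBlocks_neg]

theorem Omega_mul_self (n : ℕ) : Omega n * Omega n = -1 := by
  simp [Omega, fromBlocks_multiply, ← fromBlocks_one, fromBlocks_neg]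

theorem dotProduct_Omega_mulVec_comm {n : ℕ} (u v : Fin n ⊕ Fin n → ℝ) :
    u ⬝ᵥ Omega n *ᵥ v = -(v ⬝ᵥ Omega n *ᵥ u) := by
  rw [dotProduct_mulVec, ← mulVec_transpose, transpose_Omega, dotProduct_comm, neg_mulVec,
    dotProduct_neg]

theorem transpose_mul_Omega {n : ℕ} {X : Matrix (Fin n ⊕ Fin n) (Fin n ⊕ Fin n) ℝ}
    (hX : X ∈ sp n) : Xᵀ * Omega n = -(Omega n * X) :=
  eq_neg_of_add_eq_zero_left hX

theorem neg_mul_eq_one_of_mem_Sp {n : ℕ} {S : Matrix (Fin n ⊕ Fin n) (Fin n ⊕ Fin n) ℝ}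
    (hS : S ∈ Sp n) : -(Omega n * Sᵀ * Omega n) * S = 1 := by
  have hS' : Sᵀ * Omega n * S = Omega n := hS
  rw [neg_mul, mul_assoc, mul_assoc, ← mul_assoc Sᵀ, hS', Omega_mul_self, neg_neg]

theorem inv_eq_of_mem_Sp {n : ℕ} {S : Matrix (Fin n ⊕ Fin n) (Fin n ⊕ Fin n) ℝ}
    (hS : S ∈ Sp n) : S⁻¹ = -(Omega n * Sᵀ * Omega n) :=
  Matrix.inv_eq_left_inv (neg_mul_eq_one_of_mem_Sp hS)

theorem isUnit_det_of_mem_Sp {n : ℕ} {S : Matrix (Fin n ⊕ Fin n) (Fin n ⊕ Fin n) ℝ}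
    (hS : S ∈ Sp n) : IsUnit S.det :=
  Matrix.isUnit_det_of_left_inverse (neg_mul_eq_one_of_mem_Sp hS)

theorem exp_mem_Sp {n : ℕ} {X : Matrix (Fin n ⊕ Fin n) (Fin n ⊕ Fin n) ℝ}
    (hX : X ∈ sp n) : NormedSpace.exp X ∈ Sp n := by
  have hunit : IsUnit (Omega n) :=
    (Matrix.isUnit_iff_isUnit_det _).2 (Matrix.isUnit_det_of_left_inverse (B := -Omega n)
      (by rw [neg_mul, Omega_mul_self, neg_neg]))
  have hinv : (Omega n)⁻¹ = -Omega n :=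
    Matrix.inv_eq_left_inv (by rw [neg_mul, Omega_mul_self, neg_neg])
  have hXt : Xᵀ = Omega n * (-X) * (Omega n)⁻¹ := by
    have := congrArg (· * (-Omega n)) (transpose_mul_Omega hX)
    simp only [mul_assoc, mul_neg, neg_mul, Omega_mul_self, mul_one, neg_neg] at this
    rw [this, hinv]
    simp only [mul_assoc, mul_neg, neg_mul, neg_neg]
  change (NormedSpace.exp X)ᵀ * Omega n * NormedSpace.exp X = Omega n
  rw [← Matrix.exp_transpose, hXt, Matrix.exp_conj _ _ hunit, hinv, Matrix.exp_neg, mul_assoc,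
    mul_assoc, neg_mul, ← mul_assoc (Omega n) (Omega n), Omega_mul_self, neg_mul, neg_neg, one_mul,
    mul_assoc,
    Matrix.nonsing_inv_mul _ ((Matrix.isUnit_iff_isUnit_det _).1 (Matrix.isUnit_exp X)), mul_one]

/-- Extension of scalars of a real matrix to `ℂ`. -/
noncomputable abbrev complexify {m : Type*} [Fintype m] [DecidableEq m] :
    Matrix m m ℝ →+* Matrix m m ℂ :=
  Complex.ofRealHom.mapMatrix

theorem continuous_complexify {m : Type*} [Fintype m] [DecidableEq m] :
    Continuous (complexify : Matrix m m ℝ → Matrix m m ℂ) :=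
  Continuous.matrix_map continuous_id Complex.continuous_ofReal

theorem conjTranspose_complexify {m : Type*} [Fintype m] [DecidableEq m] (M : Matrix m m ℝ) :
    (complexify M)ᴴ = complexify Mᵀ := by
  ext i j
  simp

section

attribute [local instance] Matrix.linftyOpNormedRing Matrix.linftyOpNormedAlgebra

theorem complexify_exp {m : Type*} [Fintype m] [DecidableEq m] (M : Matrix m m ℝ) :
    complexify (NormedSpace.exp M) = NormedSpace.exp (complexify M) :=
  NormedSpace.map_exp complexify continuous_complexify M

theorem eigenvalue_re_eq_zero {n : ℕ} {X : Matrix (Fin n ⊕ Fin n) (Fin n ⊕ Fin n) ℝ}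
    (hX : X ∈ strongStable n) {z : ℂ} (hz : z ∈ spectrum ℂ (complexify X)) : z.re = 0 := by
  by_contra hre
  obtain ⟨C, hC⟩ := (hX.2.image continuous_complexify).isBounded.exists_norm_le
  set D : ℝ := C * ‖(1 : Matrix (Fin n ⊕ Fin n) (Fin n ⊕ Fin n) ℂ)‖
  have key : ∀ t : ℝ, Real.exp (t * z.re) ≤ D := by
    intro t
    have hmem : NormedSpace.exp (t • X) ∈ {S ∈ Sp n | S * X = X * S} := by
      refine ⟨exp_mem_Sp ?_, ?_⟩
      · have := transpose_mul_Omega hX.1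
        simp [sp, this]
      · exact ((Commute.refl X).smul_right t).exp_right.eq.symm
    have h1 := hC _ ⟨_, hmem, rfl⟩
    rw [complexify_exp] at h1
    have h2 : (t : ℂ) * z ∈ spectrum ℂ (complexify (t • X)) := by
      have h3 : complexify (t • X) = (t : ℂ) • complexify X := by
        ext i j
        simp
      rw [h3]
      by_cases ht : t = 0
      · subst ht
        have : Nontrivial (Matrix (Fin n ⊕ Fin n) (Fin n ⊕ Fin n) ℂ) := by
          by_contra hn
          rw [not_nontrivial_iff_subsingleton] at hn
          simp [spectrum.of_subsingleton] at hz
        simp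
      · have ht' : (t : ℂ) ≠ 0 := by exact_mod_cast ht
        exact (spectrum.smul_mem_smul_iff (r := Units.mk0 (t : ℂ) ht')).2 hz
    have h4 := spectrum.norm_le_norm_mul_of_mem (spectrum.exp_mem_exp _ h2)
    rw [← Complex.exp_eq_exp_ℂ, Complex.norm_exp] at h4
    simp only [Complex.re_ofReal_mul] at h4
    exact h4.trans (mul_le_mul_of_nonneg_right h1 (norm_nonneg _))
  have := key (D / z.re)
  rw [div_mul_cancel₀ _ hre] at this
  linarith [Real.add_one_le_exp D]

end

theorem not_isotropic_of_isCompact {n : ℕ} {X : Matrix (Fin n ⊕ Fin n) (Fin n ⊕ Fin n) ℝ}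
    (hX : X ∈ strongStable n) {a b : Fin n ⊕ Fin n → ℝ} {r : ℝ} (ha : X *ᵥ a = -(r • b))
    (hb : X *ᵥ b = r • a) (hab : a ⬝ᵥ Omega n *ᵥ b = 0) : a = 0 ∧ b = 0 := by
  have haa : a ⬝ᵥ Omega n *ᵥ a = 0 := by linarith [dotProduct_Omega_mulVec_comm a a]
  have hbb : b ⬝ᵥ Omega n *ᵥ b = 0 := by linarith [dotProduct_Omega_mulVec_comm b b]
  have hba : b ⬝ᵥ Omega n *ᵥ a = 0 := by linarith [dotProduct_Omega_mulVec_comm a b]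
  set A : Matrix (Fin n ⊕ Fin n) (Fin n ⊕ Fin n) ℝ := vecMulVec a a + vecMulVec b b with hA
  have hAt : Aᵀ = A := by simp [hA, transpose_vecMulVec]
  set B := A * Omega n with hB
  have hBt : Bᵀ = -(Omega n * A) := by
    rw [hB, transpose_mul, hAt, transpose_Omega, neg_mul]
  have hAOA : A * Omega n * A = 0 := by
    have hsq : ∀ u v w x : Fin n ⊕ Fin n → ℝ, v ⬝ᵥ Omega n *ᵥ w = 0 →
        vecMulVec u v * Omega n * vecMulVec w x = 0 := by
      intro u v w x h
      rw [mul_assoc, mul_vecMulVec, vecMulVec_mul_vecMulVec, h]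
      simp
    simp only [hA, add_mul, mul_add, hsq _ _ _ _ haa, hsq _ _ _ _ hab, hsq _ _ _ _ hba,
      hsq _ _ _ _ hbb, add_zero]
  have hcomm : B * X = X * B := by
    have h1 : Omega n * X = -(Xᵀ * Omega n) := by rw [transpose_mul_Omega hX.1, neg_neg]
    have h2 : A * Xᵀ = -(X * A) := by
      simp only [hA, add_mul, mul_add, vecMulVec_mul, vecMul_transpose, mul_vecMulVec, ha, hb]
      ext i j
      simp [vecMulVec_apply]
    rw [hB, mul_assoc, h1, mul_neg, ← mul_assoc, h2, neg_mul, neg_neg, mul_assoc]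
  have hmem : ∀ t : ℝ, 1 + t • B ∈ {S ∈ Sp n | S * X = X * S} := by
    intro t
    refine ⟨?_, ?_⟩
    · change (1 + t • B)ᵀ * Omega n * (1 + t • B) = Omega n
      have hAOAO : A * (Omega n * (A * Omega n)) = 0 := by
        rw [← mul_assoc, ← mul_assoc, hAOA, zero_mul]
      rw [transpose_add, transpose_smul, hBt, hB]
      simp only [transpose_one, add_mul, mul_add, one_mul, mul_one, smul_mul_assoc, mul_smul_comm,
        neg_mul, mul_assoc, smul_neg, hAOAO]
      simp
    · simp [add_mul, mul_add, hcomm]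
  have hB0 : B = 0 := by
    ext i j
    by_contra hij
    have hij : B i j ≠ 0 := hij
    obtain ⟨C, hC⟩ :=
      (hX.2.image (Continuous.matrix_elem continuous_id i j)).isBounded.exists_norm_le
    have := hC _ ⟨_, hmem
      ((C + 1 - (1 : Matrix (Fin n ⊕ Fin n) (Fin n ⊕ Fin n) ℝ) i j) / B i j), rfl⟩
    simp only [id, Matrix.add_apply, Matrix.smul_apply, smul_eq_mul, div_mul_cancel₀ _ hij] at this
    have := (le_abs_self _).trans this
    linarith
  have hA0 : A = 0 := by
    have : B * Omega n = -A := by rw [hB, mul_assoc, Omega_mul_self, mul_neg, mul_one]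
    rw [hB0, zero_mul] at this
    exact neg_eq_zero.1 this.symm
  have hdiag : ∀ i, a i = 0 ∧ b i = 0 := by
    intro i
    have := congrFun (congrFun hA0 i) i
    simp only [hA, Matrix.add_apply, vecMulVec_apply, Matrix.zero_apply] at this
    constructor <;> nlinarith [mul_self_nonneg (a i), mul_self_nonneg (b i)]
  exact ⟨funext fun i => (hdiag i).1, funext fun i => (hdiag i).2⟩

/-- The sesquilinear form on `ℂ²ⁿ`, conjugate-linear in the first variable, extending the standard
symplectic form. -/
noncomputable def kreinForm (n : ℕ) :
    (Fin n ⊕ Fin n → ℂ) →ₗ⋆[ℂ] (Fin n ⊕ Fin n → ℂ) →ₗ[ℂ] ℂ :=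
  LinearMap.mk₂'ₛₗ (starRingEnd ℂ) (RingHom.id ℂ)
    (fun u v => star u ⬝ᵥ complexify (Omega n) *ᵥ v)
    (fun u v w => by simp [add_dotProduct])
    (fun c u v => by simp [smul_dotProduct])
    (fun u v w => by simp [mulVec_add])
    (fun c u v => by simp [mulVec_smul])

theorem kreinForm_apply {n : ℕ} (u v : Fin n ⊕ Fin n → ℂ) :
    kreinForm n u v = star u ⬝ᵥ complexify (Omega n) *ᵥ v := rfl

theorem continuous_kreinForm {n : ℕ} {α : Type*} [TopologicalSpace α]
    {f g : α → Fin n ⊕ Fin n → ℂ} (hf : Continuous f) (hg : Continuous g) :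
    Continuous fun x => kreinForm n (f x) (g x) := by
  simp only [kreinForm_apply]
  exact hf.star.dotProduct (continuous_const.matrix_mulVec hg)

theorem kreinForm_mulVec {n : ℕ} (M N : Matrix (Fin n ⊕ Fin n) (Fin n ⊕ Fin n) ℝ)
    (u v : Fin n ⊕ Fin n → ℂ) :
    kreinForm n (complexify M *ᵥ u) (complexify N *ᵥ v) =
      star u ⬝ᵥ complexify (Mᵀ * Omega n * N) *ᵥ v := by
  rw [kreinForm_apply, star_mulVec, conjTranspose_complexify, ← dotProduct_mulVec, mulVec_mulVec,
    mulVec_mulVec, map_mul, map_mul, mul_assoc]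

theorem kreinForm_mulVec_mulVec_of_mem_Sp {n : ℕ}
    {S : Matrix (Fin n ⊕ Fin n) (Fin n ⊕ Fin n) ℝ} (hS : S ∈ Sp n) (u v : Fin n ⊕ Fin n → ℂ) :
    kreinForm n (complexify S *ᵥ u) (complexify S *ᵥ v) = kreinForm n u v := by
  have hS' : Sᵀ * Omega n * S = Omega n := hS
  rw [kreinForm_mulVec, hS', kreinForm_apply]

theorem kreinForm_mulVec_left {n : ℕ} {X : Matrix (Fin n ⊕ Fin n) (Fin n ⊕ Fin n) ℝ}
    (hX : X ∈ sp n) (u v : Fin n ⊕ Fin n → ℂ) :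
    kreinForm n (complexify X *ᵥ u) v = -kreinForm n u (complexify X *ᵥ v) := by
  have h1 := kreinForm_mulVec X 1 u v
  have h2 := kreinForm_mulVec 1 X u v
  rw [mul_one, transpose_mul_Omega hX, map_neg, neg_mulVec, dotProduct_neg] at h1
  simp only [map_one, one_mulVec, transpose_one, one_mul] at h1 h2
  rw [h1, h2]

theorem star_kreinForm {n : ℕ} (u v : Fin n ⊕ Fin n → ℂ) :
    star (kreinForm n u v) = -kreinForm n v u := by
  rw [kreinForm_apply, kreinForm_apply, ← star_dotProduct_star, star_star, star_mulVec,
    conjTranspose_complexify, transpose_Omega, map_neg, vecMul_neg, neg_dotProduct, neg_inj,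
    dotProduct_mulVec]

theorem kreinForm_self_re {n : ℕ} (u : Fin n ⊕ Fin n → ℂ) : (kreinForm n u u).re = 0 := by
  have := congrArg Complex.re (star_kreinForm u u)
  simp only [Complex.star_def, Complex.conj_re, Complex.neg_re] at this
  linarith

theorem re_complexify_mulVec {m : Type*} [Fintype m] [DecidableEq m] (M : Matrix m m ℝ)
    (u : m → ℂ) (i : m) : ((complexify M *ᵥ u) i).re = (M *ᵥ fun j => (u j).re) i := by
  simp [mulVec, dotProduct, Complex.re_sum]

theorem im_complexify_mulVec {m : Type*} [Fintype m] [DecidableEq m] (M : Matrix m m ℝ)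
    (u : m → ℂ) (i : m) : ((complexify M *ᵥ u) i).im = (M *ᵥ fun j => (u j).im) i := by
  simp [mulVec, dotProduct, Complex.im_sum]

theorem kreinForm_self_im {n : ℕ} (u : Fin n ⊕ Fin n → ℂ) :
    (kreinForm n u u).im =
      2 * ((fun i => (u i).re) ⬝ᵥ Omega n *ᵥ fun i => (u i).im) := by
  have h : (kreinForm n u u).im = ((fun i => (u i).re) ⬝ᵥ Omega n *ᵥ fun i => (u i).im) -
      ((fun i => (u i).im) ⬝ᵥ Omega n *ᵥ fun i => (u i).re) := by
    rw [kreinForm_apply, dotProduct, Complex.im_sum, dotProduct, dotProduct,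
      ← Finset.sum_sub_distrib]
    refine Finset.sum_congr rfl fun i _ => ?_
    rw [Complex.mul_im, re_complexify_mulVec, im_complexify_mulVec, Pi.star_apply,
      Complex.star_def, Complex.conj_re, Complex.conj_im]
    ring
  rw [h, dotProduct_Omega_mulVec_comm (fun i => (u i).im)]
  ring

theorem mem_spectrum_of_mulVec_eq_smul {m : Type*} [Fintype m] [DecidableEq m]
    {M : Matrix m m ℂ} {z : ℂ} {u : m → ℂ} (hu : M *ᵥ u = z • u) (hu0 : u ≠ 0) :
    z ∈ spectrum ℂ M := by
  rw [← Matrix.spectrum_toLin']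
  exact Module.End.HasEigenvalue.mem_spectrum
    (Module.End.hasEigenvalue_of_hasEigenvector (x := u)
      ⟨Module.End.mem_eigenspace_iff.2 (by rw [toLin'_apply, hu]), hu0⟩)

/-- Eigenvectors of a strongly stable element are not isotropic. -/
theorem eq_zero_of_kreinForm_self_eq_zero {n : ℕ}
    {X : Matrix (Fin n ⊕ Fin n) (Fin n ⊕ Fin n) ℝ} (hX : X ∈ strongStable n) {z : ℂ}
    {u : Fin n ⊕ Fin n → ℂ} (hu : complexify X *ᵥ u = z • u) (h0 : kreinForm n u u = 0) :
    u = 0 := by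
  by_contra hne
  have hre := eigenvalue_re_eq_zero hX (mem_spectrum_of_mulVec_eq_smul hu hne)
  have him := kreinForm_self_im u
  rw [h0, Complex.zero_im] at him
  obtain ⟨ha, hb⟩ := not_isotropic_of_isCompact hX (a := fun i => (u i).re)
    (b := fun i => (u i).im) (r := z.im) (by
      ext i
      rw [← re_complexify_mulVec, hu]
      simp [hre]) (by
      ext i
      rw [← im_complexify_mulVec, hu]
      simp [hre]) (by linarith)
  exact hne (funext fun i => Complex.ext (congrFun ha i) (congrFun hb i))

/-- The Krein form is definite on each eigenspace of a strongly stable element. -/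
theorem exists_kreinForm_pos {n : ℕ}
    {X : Matrix (Fin n ⊕ Fin n) (Fin n ⊕ Fin n) ℝ} (hX : X ∈ strongStable n) (z : ℂ) :
    ∃ c : ℂ, ∀ u : Fin n ⊕ Fin n → ℂ, complexify X *ᵥ u = z • u → u ≠ 0 →
      0 < (c * kreinForm n u u).re := by
  have hdef : (∀ u, complexify X *ᵥ u = z • u → u ≠ 0 → 0 < (kreinForm n u u).im) ∨
      ∀ u, complexify X *ᵥ u = z • u → u ≠ 0 → (kreinForm n u u).im < 0 := by
    by_contra! h
    obtain ⟨⟨v, hv, hv0, hvneg⟩, u, hu, hu0, hupos⟩ := h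
    have hne : ∀ w, complexify X *ᵥ w = z • w → w ≠ 0 → (kreinForm n w w).im ≠ 0 :=
      fun w hw hw0 h => hw0 (eq_zero_of_kreinForm_self_eq_zero hX hw
        (Complex.ext (kreinForm_self_re w) h))
    have hvneg' := lt_of_le_of_ne hvneg (hne v hv hv0)
    have hupos' := lt_of_le_of_ne hupos (hne u hu hu0).symm
    have hexp : ∀ t : ℝ, (kreinForm n (u + (t : ℂ) • v) (u + (t : ℂ) • v)).im =
        (kreinForm n v v).im * (t * t) + ((kreinForm n u v).im + (kreinForm n v u).im) * t +
          (kreinForm n u u).im := by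
      intro t
      simp only [map_add, LinearMap.add_apply, map_smulₛₗ, LinearMap.smul_apply, smul_eq_mul,
        Complex.conj_ofReal, RingHom.id_apply, Complex.add_im, Complex.im_ofReal_mul]
      ring
    obtain ⟨t, ht⟩ := exists_quadratic_eq_zero (a := (kreinForm n v v).im)
      (b := (kreinForm n u v).im + (kreinForm n v u).im) (c := (kreinForm n u u).im) hvneg'.ne
      ⟨√(discrim (kreinForm n v v).im ((kreinForm n u v).im + (kreinForm n v u).im)
        (kreinForm n u u).im), (Real.mul_self_sqrt (by
          unfold discrim
          nlinarith [sq_nonneg ((kreinForm n u v).im + (kreinForm n v u).im)])).symm⟩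
    rw [← hexp] at ht
    have hw : u + (t : ℂ) • v = 0 := by
      by_contra hw0
      refine hne _ ?_ hw0 ht
      rw [mulVec_add, mulVec_smul, hu, hv, smul_add, smul_comm]
    have hut : u = (-(t : ℂ)) • v := by
      rw [neg_smul]
      exact eq_neg_of_add_eq_zero_left hw
    rw [hut, ← Complex.ofReal_neg] at hupos'
    simp only [map_smulₛₗ, LinearMap.smul_apply, smul_eq_mul, Complex.conj_ofReal,
      RingHom.id_apply, Complex.im_ofReal_mul] at hupos'
    nlinarith [mul_self_nonneg t]
  rcases hdef with h | h
  · exact ⟨-Complex.I, fun u hu hu0 => by simpa using h u hu hu0⟩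
  · exact ⟨Complex.I, fun u hu hu0 => by simpa using h u hu hu0⟩

/-- Distinct eigenspaces of a strongly stable element are orthogonal for the Krein form. -/
theorem kreinForm_eq_zero_of_ne {n : ℕ}
    {X : Matrix (Fin n ⊕ Fin n) (Fin n ⊕ Fin n) ℝ} (hX : X ∈ strongStable n) {y z : ℂ}
    {u v : Fin n ⊕ Fin n → ℂ} (hu : complexify X *ᵥ u = y • u) (hv : complexify X *ᵥ v = z • v)
    (hyz : y ≠ z) : kreinForm n u v = 0 := by
  by_cases hu0 : u = 0
  · simp [hu0]
  have hre := eigenvalue_re_eq_zero hX (mem_spectrum_of_mulVec_eq_smul hu hu0)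
  have hconj : (starRingEnd ℂ) y = -y := by
    apply Complex.ext <;> simp [hre]
  have h := kreinForm_mulVec_left hX.1 u v
  rw [hu, hv, map_smulₛₗ, LinearMap.smul_apply, map_smul, hconj, smul_eq_mul, smul_eq_mul, neg_mul,
    neg_inj] at h
  exact (mul_eq_mul_right_iff.1 h).resolve_left hyz

/-- A strongly stable element is diagonalizable over `ℂ`. -/
theorem iSup_eigenspace_eq_top {n : ℕ}
    {X : Matrix (Fin n ⊕ Fin n) (Fin n ⊕ Fin n) ℝ} (hX : X ∈ strongStable n) :
    ⨆ z, Module.End.eigenspace (toLin' (complexify X)) z = ⊤ := by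
  rw [← Module.End.iSup_maxGenEigenspace_eq_top (toLin' (complexify X))]
  refine le_antisymm (iSup_mono fun z => Module.End.genEigenspace_le_maximal _ z 1)
    (iSup_mono fun z u hu => ?_)
  obtain ⟨k, hk⟩ := (Module.End.mem_maxGenEigenspace _ _ _).1 hu
  induction k generalizing u with
  | zero =>
    rw [pow_zero, Module.End.one_apply] at hk
    rw [hk]
    exact Submodule.zero_mem _
  | succ k ih =>
    set w := (toLin' (complexify X) - z • 1) u with hw
    have hw' : w = complexify X *ᵥ u - z • u := by simp [hw]
    have hwmem : w ∈ Module.End.eigenspace (toLin' (complexify X)) z := by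
      rw [pow_succ, Module.End.mul_apply] at hk
      exact ih _ ((Module.End.mem_maxGenEigenspace _ _ _).2 ⟨k, hk⟩) hk
    have hXw : complexify X *ᵥ w = z • w := by
      simpa [toLin'_apply] using Module.End.mem_eigenspace_iff.1 hwmem
    have hw0 : w = 0 := by
      by_contra hne
      have hre := eigenvalue_re_eq_zero hX (mem_spectrum_of_mulVec_eq_smul hXw hne)
      have hconj : (starRingEnd ℂ) z = -z := by
        apply Complex.ext <;> simp [hre]
      refine hne (eq_zero_of_kreinForm_self_eq_zero hX hXw ?_)
      have h := kreinForm_mulVec_left hX.1 w u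
      rw [hXw, map_smulₛₗ, LinearMap.smul_apply, hconj, smul_eq_mul, neg_mul, neg_inj] at h
      nth_rewrite 2 [hw']
      rw [map_sub, ← h, map_smul, smul_eq_mul, sub_self]
    rw [Module.End.mem_eigenspace_iff, toLin'_apply]
    rwa [hw', sub_eq_zero] at hw0

/-- Some polynomial in a strongly stable element makes the Krein form positive definite. -/
theorem exists_polynomial_kreinForm_pos {n : ℕ}
    {X : Matrix (Fin n ⊕ Fin n) (Fin n ⊕ Fin n) ℝ} (hX : X ∈ strongStable n) :
    ∃ p : Polynomial ℂ, ∀ u : Fin n ⊕ Fin n → ℂ, u ≠ 0 →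
      0 < (kreinForm n u (Polynomial.aeval (complexify X) p *ᵥ u)).re := by
  choose c hc using exists_kreinForm_pos hX
  set f : Module.End ℂ (Fin n ⊕ Fin n → ℂ) := toLin' (complexify X) with hf
  set s := (Module.End.finite_hasEigenvalue f).toFinset
  refine ⟨Lagrange.interpolate s id c, fun u hu => ?_⟩
  set p := Lagrange.interpolate s id c
  obtain ⟨g, hg, rfl⟩ := (Submodule.mem_iSup_iff_exists_finsupp _ u).1
    (show u ∈ ⨆ z, Module.End.eigenspace f z by
      rw [iSup_eigenspace_eq_top hX]
      exact Submodule.mem_top)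
  have hXg : ∀ z, complexify X *ᵥ g z = z • g z := fun z => by
    simpa [hf, toLin'_apply] using Module.End.mem_eigenspace_iff.1 (hg z)
  have hpg : ∀ z ∈ g.support, Polynomial.aeval (complexify X) p *ᵥ g z = c z • g z := by
    intro z hz
    have hvec : f.HasEigenvector z (g z) := ⟨hg z, Finsupp.mem_support_iff.1 hz⟩
    have hzs : z ∈ s := (Set.Finite.mem_toFinset _).2
      (Module.End.hasEigenvalue_of_hasEigenvector hvec)
    have h := Module.End.aeval_apply_of_hasEigenvector (p := p) hvec
    have heval : Polynomial.eval z p = c z :=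
      Lagrange.eval_interpolate_at_node c (v := id) (fun _ _ _ _ h => h) hzs
    have haeval : Polynomial.aeval f p = toLin' (Polynomial.aeval (complexify X) p) :=
      Polynomial.aeval_algHom_apply (toLinAlgEquiv' : Matrix _ _ ℂ ≃ₐ[ℂ] _) (complexify X) p
    rwa [heval, haeval, toLin'_apply] at h
  have hsum : kreinForm n (g.sum fun _ x => x)
      (Polynomial.aeval (complexify X) p *ᵥ g.sum fun _ x => x) =
        ∑ z ∈ g.support, c z * kreinForm n (g z) (g z) := by
    rw [Finsupp.sum, mulVec_sum, map_sum (kreinForm n), LinearMap.sum_apply]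
    refine Finset.sum_congr rfl fun y hy => ?_
    rw [map_sum, Finset.sum_eq_single y]
    · rw [hpg y hy, map_smul, smul_eq_mul]
    · intro z hz hzy
      rw [hpg z hz, map_smul, kreinForm_eq_zero_of_ne hX (hXg y) (hXg z) hzy.symm, smul_zero]
    · exact fun h => absurd hy h
  rw [hsum, Complex.re_sum]
  refine Finset.sum_pos (fun z hz => hc z _ (hXg z) (Finsupp.mem_support_iff.1 hz)) ?_
  rw [Finset.nonempty_iff_ne_empty]
  intro h
  exact hu (by rw [Finsupp.sum, h, Finset.sum_empty])

/-- Conjugation by a symplectic matrix `S` transports the forms defined by polynomials. -/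
theorem kreinForm_aeval_conj {n : ℕ} {S X Y : Matrix (Fin n ⊕ Fin n) (Fin n ⊕ Fin n) ℝ}
    (hS : S ∈ Sp n) (h : Y * S = S * X) (p : Polynomial ℂ) (u : Fin n ⊕ Fin n → ℂ) :
    kreinForm n (complexify S *ᵥ u)
      (Polynomial.aeval (complexify Y) p *ᵥ (complexify S *ᵥ u)) =
        kreinForm n u (Polynomial.aeval (complexify X) p *ᵥ u) := by
  have hc : complexify Y * complexify S = complexify S * complexify X := by
    rw [← map_mul, h, map_mul]
  have hp : Polynomial.aeval (complexify Y) p * complexify S =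
      complexify S * Polynomial.aeval (complexify X) p := by
    induction p using Polynomial.induction_on' with
    | add p q hp hq => rw [map_add, map_add, add_mul, mul_add, hp, hq]
    | monomial k a =>
      have hk : SemiconjBy (complexify S) (complexify X) (complexify Y) := hc.symm
      rw [Polynomial.aeval_monomial, Polynomial.aeval_monomial, mul_assoc, ← (hk.pow_right k).eq,
        ← mul_assoc, Algebra.commutes, mul_assoc]
  rw [mulVec_mulVec, hp, ← mulVec_mulVec, kreinForm_mulVec_mulVec_of_mem_Sp hS]

/-- Near a strongly stable element a single polynomial yields uniformly positive forms. -/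
theorem exists_polynomial_eventually_le {n : ℕ}
    {X : Matrix (Fin n ⊕ Fin n) (Fin n ⊕ Fin n) ℝ} (hX : X ∈ strongStable n) :
    ∃ p : Polynomial ℂ, ∃ c > 0, ∀ᶠ Y in nhds X, ∀ u : Fin n ⊕ Fin n → ℂ,
      c * ‖u‖ ^ 2 ≤ (kreinForm n u (Polynomial.aeval (complexify Y) p *ᵥ u)).re := by
  obtain ⟨p, hp⟩ := exists_polynomial_kreinForm_pos hX
  set F : Matrix (Fin n ⊕ Fin n) (Fin n ⊕ Fin n) ℝ → (Fin n ⊕ Fin n → ℂ) → ℝ :=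
    fun Y u => (kreinForm n u (Polynomial.aeval (complexify Y) p *ᵥ u)).re with hF
  have hcont : Continuous fun q : Matrix (Fin n ⊕ Fin n) (Fin n ⊕ Fin n) ℝ ×
      (Fin n ⊕ Fin n → ℂ) => F q.1 q.2 :=
    Complex.continuous_re.comp (continuous_kreinForm continuous_snd
      (((p.continuous_aeval.comp (continuous_complexify.comp continuous_fst))).matrix_mulVec
        continuous_snd))
  have hsphere : IsCompact (Metric.sphere (0 : Fin n ⊕ Fin n → ℂ) 1) := isCompact_sphere 0 1
  have hne : ∀ u ∈ Metric.sphere (0 : Fin n ⊕ Fin n → ℂ) 1, u ≠ 0 := by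
    rintro u hu rfl
    simp at hu
  obtain ⟨c, hc0, hc⟩ : ∃ c > 0, ∀ u ∈ Metric.sphere (0 : Fin n ⊕ Fin n → ℂ) 1, c < F X u := by
    obtain ⟨c, hc0, hc⟩ := hsphere.exists_forall_le' (f := F X) (a := 0)
      (hcont.comp (Continuous.prodMk_right X)).continuousOn (fun u hu => hp u (hne u hu))
    exact ⟨c / 2, half_pos hc0, fun u hu => (half_lt_self hc0).trans_le (hc u hu)⟩
  refine ⟨p, c, hc0, ?_⟩
  have hev : ∀ᶠ Y in nhds X, ∀ u ∈ Metric.sphere (0 : Fin n ⊕ Fin n → ℂ) 1, c < F Y u :=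
    hsphere.eventually_forall_of_forall_eventually fun u hu =>
      hcont.continuousAt.eventually_const_lt (hc u hu)
  filter_upwards [hev] with Y hY u
  by_cases hu : u = 0
  · simp [hu]
  have hnorm : ‖u‖ ≠ 0 := norm_ne_zero_iff.2 hu
  have h := (hY ((‖u‖⁻¹ : ℂ) • u) (by simp [norm_smul, hnorm])).le
  have hscale : F Y ((‖u‖⁻¹ : ℂ) • u) = (‖u‖ ^ 2)⁻¹ * F Y u := by
    simp only [hF, mulVec_smul, map_smul, map_smulₛₗ, LinearMap.smul_apply, smul_eq_mul, map_inv₀,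
      Complex.conj_ofReal, ← mul_assoc]
    rw [← Complex.ofReal_inv, ← Complex.ofReal_mul, Complex.re_ofReal_mul]
    congr 1
    rw [sq, mul_inv]
  rw [hscale, inv_mul_eq_div, le_div_iff₀ (by positivity)] at h
  exact h

theorem exists_bound_of_conj_mem {n : ℕ}
    {K L : Set (Matrix (Fin n ⊕ Fin n) (Fin n ⊕ Fin n) ℝ)} (hK : IsCompact K) (hL : IsCompact L)
    (hKs : K ⊆ strongStable n) :
    ∃ C : ℝ, ∀ S ∈ Sp n, ∀ X ∈ L, S * X * S⁻¹ ∈ K → ∀ i j, |S i j| ≤ C := by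
  refine hK.induction_on
    (p := fun t => ∃ C : ℝ, ∀ S ∈ Sp n, ∀ X ∈ L, S * X * S⁻¹ ∈ t → ∀ i j, |S i j| ≤ C)
    ⟨0, fun _ _ _ _ h => h.elim⟩ ?_ ?_ ?_
  · rintro s t hst ⟨C, hC⟩
    exact ⟨C, fun S hS X hX h => hC S hS X hX (hst h)⟩
  · rintro s t ⟨C, hC⟩ ⟨D, hD⟩
    refine ⟨max C D, fun S hS X hX h i j => ?_⟩
    rcases h with h | h
    · exact (hC S hS X hX h i j).trans (le_max_left _ _)
    · exact (hD S hS X hX h i j).trans (le_max_right _ _)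
  · intro Y hY
    obtain ⟨p, c, hc, hev⟩ := exists_polynomial_eventually_le (hKs hY)
    refine ⟨_, mem_nhdsWithin_of_mem_nhds hev, ?_⟩
    have hbdd : ∀ j, ∃ M : ℝ, ∀ X ∈ L, (kreinForm n (Pi.single j 1)
        (Polynomial.aeval (complexify X) p *ᵥ Pi.single j 1)).re ≤ M := by
      intro j
      obtain ⟨M, hM⟩ := hL.bddAbove_image (f := fun X => (kreinForm n (Pi.single j 1)
        (Polynomial.aeval (complexify X) p *ᵥ Pi.single j 1)).re)
        (Complex.continuous_re.comp (continuous_kreinForm continuous_const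
          ((p.continuous_aeval.comp continuous_complexify).matrix_mulVec
            continuous_const))).continuousOn
      exact ⟨M, fun X hX => hM ⟨X, hX, rfl⟩⟩
    choose M hM using hbdd
    refine ⟨∑ j, |M j| / c + 1, fun S hS X hX h i j => ?_⟩
    have hconj : S * X * S⁻¹ * S = S * X := by
      rw [mul_assoc, Matrix.nonsing_inv_mul _ (isUnit_det_of_mem_Sp hS), mul_one]
    have h1 := h (complexify S *ᵥ Pi.single j 1)
    rw [kreinForm_aeval_conj hS hconj] at h1
    have h2 : |S i j| ≤ ‖complexify S *ᵥ Pi.single j 1‖ := by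
      refine le_trans (le_of_eq ?_) (norm_le_pi_norm (complexify S *ᵥ Pi.single j 1) i)
      simp
    have h3 : |S i j| ^ 2 ≤ |M j| / c := by
      rw [le_div_iff₀ hc, mul_comm]
      calc c * |S i j| ^ 2 ≤ c * ‖complexify S *ᵥ Pi.single j 1‖ ^ 2 := by gcongr
        _ ≤ |M j| := (h1.trans (hM j X hX)).trans (le_abs_self _)
    have h4 : |M j| / c ≤ ∑ j, |M j| / c :=
      Finset.single_le_sum (f := fun j => |M j| / c) (fun _ _ => by positivity)
        (Finset.mem_univ j)
    nlinarith [sq_nonneg (|S i j| - 1)]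

/-- The conjugation (adjoint) action of `Sp(2n,ℝ)` on the set `𝒟` of
strongly stable elements is proper: the preimage under the action map
`(S, X) ↦ (S X S⁻¹, X)` of any compact subset of `𝒟 × 𝒟` is compact. -/
theorem adjoint_action_proper_on_strongStable (n : ℕ) :
    ∀ K : Set (Matrix (Fin n ⊕ Fin n) (Fin n ⊕ Fin n) ℝ ×
              Matrix (Fin n ⊕ Fin n) (Fin n ⊕ Fin n) ℝ),
      K ⊆ strongStable n ×ˢ strongStable n → IsCompact K →
      IsCompact {p : Matrix (Fin n ⊕ Fin n) (Fin n ⊕ Fin n) ℝ ×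
                     Matrix (Fin n ⊕ Fin n) (Fin n ⊕ Fin n) ℝ |
        p.1 ∈ Sp n ∧ p.2 ∈ strongStable n ∧ (p.1 * p.2 * p.1⁻¹, p.2) ∈ K} := by
  intro K hKs hK
  obtain ⟨C, hC⟩ := exists_bound_of_conj_mem (hK.image continuous_fst) (hK.image continuous_snd)
    (by rintro _ ⟨q, hq, rfl⟩; exact (hKs hq).1)
  have hbox : IsCompact ({S : Matrix (Fin n ⊕ Fin n) (Fin n ⊕ Fin n) ℝ |
      ∀ i j, S i j ∈ Set.Icc (-C) C} ×ˢ (Prod.snd '' K)) := by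
    refine IsCompact.prod ?_ (hK.image continuous_snd)
    have := isCompact_univ_pi fun _ : Fin n ⊕ Fin n =>
      isCompact_univ_pi fun _ : Fin n ⊕ Fin n => isCompact_Icc (a := -C) (b := C)
    simp only [Set.pi, Set.mem_univ, forall_const, Set.mem_ofPred_eq] at this
    exact this
  refine hbox.of_isClosed_subset ?_ ?_
  · have hset : {p : Matrix (Fin n ⊕ Fin n) (Fin n ⊕ Fin n) ℝ ×
        Matrix (Fin n ⊕ Fin n) (Fin n ⊕ Fin n) ℝ |
        p.1 ∈ Sp n ∧ p.2 ∈ strongStable n ∧ (p.1 * p.2 * p.1⁻¹, p.2) ∈ K} =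
        {p | p.1ᵀ * Omega n * p.1 = Omega n} ∩
          (fun p => (p.1 * p.2 * -(Omega n * p.1ᵀ * Omega n), p.2)) ⁻¹' K := by
      ext p
      constructor
      · rintro ⟨h1, -, h3⟩
        rw [inv_eq_of_mem_Sp h1] at h3
        exact ⟨h1, h3⟩
      · rintro ⟨h1, h3⟩
        refine ⟨h1, (hKs h3).2, ?_⟩
        rw [inv_eq_of_mem_Sp h1]
        exact h3
    rw [hset]
    refine (isClosed_eq ?_ continuous_const).inter (hK.isClosed.preimage ?_)
    · fun_prop
    · fun_prop
  · rintro p ⟨h1, -, h3⟩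
    exact ⟨fun i j => abs_le.1 (hC _ h1 _ ⟨_, h3, rfl⟩ ⟨_, h3, rfl⟩ i j), ⟨_, h3, rfl⟩⟩
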